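/- Let 0 < α < 1. For every s ≥ 0, the function x ↦ (x/(1−x))^{αx} sin(απx) e^{−sx} is integrable on (0,1) and φ_α(s) = (1/π) ∫_0^1 (x/(1−x))^{αx} sin(απx) e^{−sx} dx. In particular φ_α(s) > 0 for all s ≥ 0. -/

import Mathlib

open MeasureTheory Filter Set Asymptotics

/-- The sequence of polynomials `p_n(α)` defined by `p_0(α) = 1` and
`p_{n+1}(α) = (α/(n+1)) · Σ_{k=0}^{n} ((k+1)/(k+2)) p_{n−k}(α)`. -/
noncomputable def bmpP {K : Type*} [Field K] (α : K) : ℕ → K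
  | 0 => 1
  | n + 1 => (α / (n + 1)) * ∑ k ∈ Finset.range (n + 1), ((k + 1 : K) / (k + 2)) * bmpP α (n - k)
  decreasing_by exact Nat.lt_succ_of_le (Nat.sub_le n k)

/-- The real function `φ_α(s) = e^α Σ_{n≥0} (−1)^n p_{n+1}(α) s^n/n!` for real `α`. -/
noncomputable def bmpPhiR (α s : ℝ) : ℝ :=
  Real.exp α * ∑' n : ℕ, (-1) ^ n * bmpP α (n + 1) * s ^ n / n.factorial

lemma bmpP_succ {K : Type*} [Field K] (α : K) (n : ℕ) :
    bmpP α (n + 1) = (α / (n + 1)) *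
      ∑ k ∈ Finset.range (n + 1), ((k + 1 : K) / (k + 2)) * bmpP α (n - k) := by
  rw [bmpP]

lemma bmpP_nonneg {α : ℝ} (h0 : 0 ≤ α) (n : ℕ) : 0 ≤ bmpP α n := by
  induction n using Nat.strong_induction_on with
  | _ n ih =>
    cases n with
    | zero => rw [bmpP]; exact zero_le_one
    | succ n =>
      rw [bmpP_succ]
      refine mul_nonneg (by positivity) (Finset.sum_nonneg fun k _ => ?_)
      exact mul_nonneg (by positivity) (ih _ (by omega))

lemma bmpP_succ_le {α : ℝ} (h0 : 0 ≤ α) (n : ℕ) :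
    bmpP α (n + 1) ≤ α / (n + 1) * ∑ k ∈ Finset.range (n + 1), bmpP α k := by
  rw [bmpP_succ, ← Finset.sum_range_reflect (fun k => bmpP α k)]
  refine mul_le_mul_of_nonneg_left (Finset.sum_le_sum fun k _ => ?_) (by positivity)
  rw [show n + 1 - 1 - k = n - k by omega]
  refine mul_le_of_le_one_left (bmpP_nonneg h0 _) ?_
  rw [div_le_one (by positivity)]
  linarith

lemma bmpP_le_one {α : ℝ} (h0 : 0 ≤ α) (h1 : α ≤ 1) (n : ℕ) : bmpP α n ≤ 1 := by
  induction n using Nat.strong_induction_on with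
  | _ n ih =>
    cases n with
    | zero => rw [bmpP]
    | succ n =>
      refine (bmpP_succ_le h0 n).trans ?_
      have : ∑ k ∈ Finset.range (n + 1), bmpP α k ≤ ∑ k ∈ Finset.range (n + 1), (1 : ℝ) :=
        Finset.sum_le_sum fun k hk => ih k (Finset.mem_range.1 hk)
      calc _ ≤ α / (n + 1) * ∑ k ∈ Finset.range (n + 1), (1 : ℝ) := by gcongr
        _ = α := by simp; field_simp
        _ ≤ 1 := h1

lemma sum_bmpP_le {α : ℝ} (h0 : 0 ≤ α) (n : ℕ) :
    ∑ k ∈ Finset.range (n + 1), bmpP α k ≤ Real.exp (α * harmonic n) := by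
  induction n with
  | zero => simp [bmpP]
  | succ n ih =>
    rw [Finset.sum_range_succ, harmonic_succ]
    have h := bmpP_succ_le h0 n
    have h2 := Real.add_one_le_exp (α / (n + 1))
    have h3 : 0 ≤ ∑ k ∈ Finset.range (n + 1), bmpP α k :=
      Finset.sum_nonneg fun k _ => bmpP_nonneg h0 k
    calc _ ≤ (∑ k ∈ Finset.range (n + 1), bmpP α k) * (α / (n + 1) + 1) := by linarith
      _ ≤ Real.exp (α * harmonic n) * Real.exp (α / (n + 1)) := by gcongr
      _ = _ := by
        rw [← Real.exp_add]; congr 1; push_cast; ring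

lemma tendsto_bmpP_atTop {α : ℝ} (h0 : 0 ≤ α) (h1 : α < 1) :
    Tendsto (fun n => bmpP α (n + 1)) atTop (nhds 0) := by
  have hb : ∀ n : ℕ, bmpP α (n + 2) ≤ α * Real.exp α * ((n + 1 : ℕ) : ℝ) ^ (-(1 - α)) := by
    intro n
    have hpos : (0 : ℝ) < ((n + 1 : ℕ) : ℝ) := by positivity
    have h := bmpP_succ_le h0 (n + 1)
    have hs := sum_bmpP_le h0 (n + 1)
    have hh := harmonic_le_one_add_log (n + 1)
    calc _ ≤ α / ((n + 1 : ℕ) + 1) * ∑ k ∈ Finset.range (n + 1 + 1), bmpP α k := h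
      _ ≤ α / ((n + 1 : ℕ)) * Real.exp (α * (1 + Real.log (n + 1 : ℕ))) := by
        gcongr
        · exact Finset.sum_nonneg fun k _ => bmpP_nonneg h0 k
        · linarith
        · exact hs.trans (by gcongr)
      _ = _ := by
        rw [mul_add, mul_one, Real.exp_add, neg_sub, Real.rpow_sub hpos, Real.rpow_one,
          Real.rpow_def_of_pos hpos, mul_comm α (Real.log _)]
        ring
  rw [← tendsto_add_atTop_iff_nat 1]
  refine squeeze_zero (fun n => bmpP_nonneg h0 _) hb ?_
  rw [← mul_zero (α * Real.exp α)]
  refine Tendsto.const_mul _ ?_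
  exact ((tendsto_rpow_neg_atTop (by linarith)).comp tendsto_natCast_atTop_atTop).comp
    (tendsto_add_atTop_nat 1)

lemma summable_mul_pow_of_norm_le_one {a : ℕ → ℂ} (ha : ∀ k, ‖a k‖ ≤ 1) {z : ℂ}
    (hz : ‖z‖ < 1) : Summable fun k => ‖a k * z ^ k‖ := by
  refine Summable.of_nonneg_of_le (fun _ => norm_nonneg _) (fun k => ?_)
    (summable_geometric_of_lt_one (norm_nonneg z) hz)
  rw [norm_mul, norm_pow]
  exact mul_le_of_le_one_left (by positivity) (ha k)

lemma hasDerivAt_tsum_mul_pow {a : ℕ → ℂ} (ha : ∀ k, ‖a k‖ ≤ 1) {z : ℂ} (hz : ‖z‖ < 1) :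
    HasDerivAt (fun z => ∑' k, a k * z ^ k) (∑' k : ℕ, (k + 1) * a (k + 1) * z ^ k) z := by
  obtain ⟨r, hr1, hr2⟩ := exists_between hz
  have hr0 : 0 ≤ r := (norm_nonneg z).trans hr1.le
  have hu : Summable fun k : ℕ => (k : ℝ) * r ^ (k - 1) := by
    rw [← summable_nat_add_iff 1]
    have h1 : Summable fun k : ℕ => (k : ℝ) ^ 1 * r ^ k :=
      summable_pow_mul_geometric_of_norm_lt_one 1 (by rwa [Real.norm_of_nonneg hr0])
    have h2 := h1.add (summable_geometric_of_lt_one hr0 hr2)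
    refine h2.congr fun k => ?_
    simp; ring
  have hd : ∀ k : ℕ, ∀ y ∈ Metric.ball (0 : ℂ) r,
      HasDerivAt (fun z => a k * z ^ k) (a k * (k * y ^ (k - 1))) y :=
    fun k y _ => (hasDerivAt_pow k y).const_mul _
  have hb : ∀ k : ℕ, ∀ y ∈ Metric.ball (0 : ℂ) r,
      ‖a k * (k * y ^ (k - 1))‖ ≤ k * r ^ (k - 1) := by
    intro k y hy
    rw [norm_mul, norm_mul, norm_pow, Complex.norm_natCast]
    have : ‖y‖ ≤ r := (mem_ball_zero_iff.1 hy).le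
    calc _ ≤ 1 * (k * r ^ (k - 1)) := by gcongr; exact ha k
      _ = _ := one_mul _
  have hz' : z ∈ Metric.ball (0 : ℂ) r := mem_ball_zero_iff.2 hr1
  have hsum := (summable_mul_pow_of_norm_le_one ha hz).of_norm
  have := hasDerivAt_tsum_of_isPreconnected hu Metric.isOpen_ball
    (convex_ball (0 : ℂ) r).isPreconnected hd hb hz' hsum hz'
  refine this.congr_deriv ?_
  rw [Summable.tsum_eq_zero_add (.of_norm_bounded hu fun k => hb k z hz')]
  simp only [Nat.cast_zero, zero_mul, mul_zero, zero_add, Nat.add_sub_cancel]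
  refine tsum_congr fun k => ?_
  push_cast; ring

lemma norm_bmpP_le_one {α : ℝ} (h0 : 0 ≤ α) (h1 : α ≤ 1) (k : ℕ) : ‖((bmpP α k : ℝ) : ℂ)‖ ≤ 1 := by
  rw [Complex.norm_real, Real.norm_of_nonneg (bmpP_nonneg h0 k)]
  exact bmpP_le_one h0 h1 k

lemma tsum_bmpP_mul_pow {α : ℝ} (h0 : 0 ≤ α) (h1 : α ≤ 1) {z : ℂ} (hz : ‖z‖ < 1) :
    Complex.exp α * ∑' k, ((bmpP α k : ℝ) : ℂ) * z ^ k =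
      Complex.exp (α * ∑' k : ℕ, (1 / (k + 1) : ℂ) * z ^ k) := by
  have hl : ∀ k : ℕ, ‖(1 / (k + 1) : ℂ)‖ ≤ 1 := by
    intro k
    rw [show (1 / (k + 1) : ℂ) = ((1 / (k + 1) : ℝ) : ℂ) by push_cast; rfl, Complex.norm_real,
      Real.norm_of_nonneg (by positivity), div_le_one (by positivity)]
    linarith [k.cast_nonneg (α := ℝ)]
  have hp := norm_bmpP_le_one h0 h1
  set P : ℂ → ℂ := fun z => ∑' k, ((bmpP α k : ℝ) : ℂ) * z ^ k with hP
  set L : ℂ → ℂ := fun z => ∑' k : ℕ, (1 / (k + 1) : ℂ) * z ^ k with hL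
  have hcoef : ∀ k : ℕ, ‖((k + 1) * (1 / ((k + 1 : ℕ) + 1)) : ℂ)‖ ≤ 1 := by
    intro k
    rw [show ((k + 1) * (1 / ((k + 1 : ℕ) + 1)) : ℂ)
      = (((k + 1) * (1 / (k + 1 + 1)) : ℝ) : ℂ) by push_cast; rfl, Complex.norm_real,
      Real.norm_of_nonneg (by positivity), mul_one_div, div_le_one (by positivity)]
    linarith [k.cast_nonneg (α := ℝ)]
  have hd : ∀ z ∈ Metric.ball (0 : ℂ) 1,
      HasDerivAt (fun z => P z * Complex.exp (-(α * L z))) 0 z := by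
    intro z hz
    have hz := mem_ball_zero_iff.1 hz
    have hPd := hasDerivAt_tsum_mul_pow hp hz
    have hLd := hasDerivAt_tsum_mul_pow hl hz
    have hode : (∑' k : ℕ, ((k : ℂ) + 1) * ((bmpP α (k + 1) : ℝ) : ℂ) * z ^ k)
        = α * ((∑' k : ℕ, ((k : ℂ) + 1) * (1 / ((k + 1 : ℕ) + 1)) * z ^ k) * P z) := by
      rw [hP, tsum_mul_tsum_eq_tsum_sum_range_of_summable_norm
        (summable_mul_pow_of_norm_le_one hcoef hz) (summable_mul_pow_of_norm_le_one hp hz),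
        ← tsum_mul_left]
      refine tsum_congr fun n => ?_
      rw [bmpP_succ]
      push_cast
      have hn : (n : ℂ) + 1 ≠ 0 := Nat.cast_add_one_ne_zero n
      rw [← mul_assoc, mul_div_cancel₀ _ hn, mul_assoc, Finset.sum_mul]
      congr 1
      refine Finset.sum_congr rfl fun k hk => ?_
      have hk : k + (n - k) = n := by have := Finset.mem_range.1 hk; omega
      nth_rewrite 2 [← hk]
      rw [pow_add, show (k : ℂ) + 1 + 1 = k + 2 by ring]
      ring
    have := hPd.mul ((hLd.const_mul (α : ℂ)).neg.cexp)
    refine this.congr_deriv ?_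
    rw [hode]
    simp only [Pi.neg_apply]
    ring
  have hc := Metric.isOpen_ball.is_const_of_deriv_eq_zero
    (convex_ball (0 : ℂ) 1).isPreconnected
    (fun z hz => (hd z hz).differentiableAt.differentiableWithinAt)
    (fun z hz => (hd z hz).deriv) (mem_ball_zero_iff.2 hz)
    (Metric.mem_ball_self zero_lt_one : (0 : ℂ) ∈ Metric.ball (0 : ℂ) 1)
  have hP0 : P 0 = 1 := by
    rw [hP]; simp only []
    rw [tsum_eq_single 0 (by intro k hk; simp [hk])]
    simp [bmpP]
  have hL0 : L 0 = 1 := by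
    rw [hL]; simp only []
    rw [tsum_eq_single 0 (by intro k hk; simp [hk])]
    simp
  simp only [hP0, hL0, one_mul, mul_one, Complex.exp_neg] at hc
  change Complex.exp α * P z = Complex.exp (α * L z)
  have e1 := Complex.exp_ne_zero (α * L z)
  have e2 := Complex.exp_ne_zero (α : ℂ)
  field_simp at hc
  rw [mul_comm]; exact hc

lemma exp_mul_neg_log_one_sub_eq {α : ℝ} (h0 : 0 ≤ α) (h1 : α ≤ 1) {z : ℂ} (hz : ‖z‖ < 1)
    (hz0 : z ≠ 0) :
    Complex.exp (α * (z⁻¹ * -Complex.log (1 - z))) =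
      Complex.exp α * ∑' k, ((bmpP α k : ℝ) : ℂ) * z ^ k := by
  rw [tsum_bmpP_mul_pow h0 h1 hz]
  have h := (Complex.hasSum_taylorSeries_neg_log hz)
  have h2 := ((hasSum_nat_add_iff' 1).2 h).mul_left z⁻¹
  simp only [Finset.range_one, Finset.sum_singleton, pow_zero, Nat.cast_zero, div_zero,
    sub_zero] at h2
  rw [← h2.tsum_eq]
  congr 2
  refine tsum_congr fun k => ?_
  rw [pow_succ]; push_cast; field_simp

/-- The weight `(x/(1-x))^{αx} sin(απx)`. -/
noncomputable def bmpWeight (α x : ℝ) : ℝ :=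
  (x / (1 - x)) ^ (α * x) * Real.sin (α * Real.pi * x)

lemma bmpWeight_pos {α x : ℝ} (h0 : 0 < α) (h1 : α < 1) (hx : x ∈ Ioo (0 : ℝ) 1) :
    0 < bmpWeight α x := by
  have hx0 := hx.1
  have hx1 : 0 < 1 - x := sub_pos.2 hx.2
  refine mul_pos (Real.rpow_pos_of_pos (by positivity) _) (Real.sin_pos_of_pos_of_lt_pi
    (by positivity) ?_)
  have : α * x < 1 := by nlinarith
  nlinarith [Real.pi_pos]

lemma measurable_bmpWeight (α : ℝ) : Measurable (bmpWeight α) := by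
  unfold bmpWeight; fun_prop

lemma bmpWeight_le {α x : ℝ} (h0 : 0 < α) (hx : x ∈ Ioo (0 : ℝ) 1) :
    bmpWeight α x ≤ (1 - x) ^ (-α) := by
  have hx0 := hx.1
  have hx1 : 0 < 1 - x := sub_pos.2 hx.2
  have ha : x ^ (α * x) ≤ 1 := Real.rpow_le_one hx0.le hx.2.le (by positivity)
  have hb : (1 - x) ^ (-(α * x)) ≤ (1 - x) ^ (-α) :=
    Real.rpow_le_rpow_of_exponent_ge hx1 (by linarith) (by nlinarith)
  calc bmpWeight α x ≤ (x / (1 - x)) ^ (α * x) :=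
        mul_le_of_le_one_right (by positivity) (Real.sin_le_one _)
    _ = x ^ (α * x) * (1 - x) ^ (-(α * x)) := by
        rw [Real.div_rpow hx0.le hx1.le, Real.rpow_neg hx1.le, div_eq_mul_inv]
    _ ≤ 1 * (1 - x) ^ (-α) := by gcongr
    _ = _ := one_mul _

lemma integrableOn_bmpWeight {α : ℝ} (h0 : 0 < α) (h1 : α < 1) :
    IntegrableOn (bmpWeight α) (Ioo 0 1) := by
  have h : IntegrableOn (fun x : ℝ => (1 - x) ^ (-α)) (Ioo 0 1) := by
    have h2 := (intervalIntegral.intervalIntegrable_rpow' (a := 1) (b := 0)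
      (show -1 < -α by linarith)).comp_sub_left 1
    simp only [sub_self, sub_zero] at h2
    rw [intervalIntegrable_iff_integrableOn_Ioo_of_le zero_le_one] at h2
    exact h2
  refine h.mono' (measurable_bmpWeight α).aestronglyMeasurable ?_
  filter_upwards [ae_restrict_mem measurableSet_Ioo] with x hx
  rw [Real.norm_of_nonneg (bmpWeight_pos h0 h1 hx).le]
  exact bmpWeight_le h0 hx

lemma integrableOn_mul_bmpWeight {α : ℝ} (h0 : 0 < α) (h1 : α < 1) {f : ℝ → ℝ}
    (hf : Continuous f) : IntegrableOn (fun x => f x * bmpWeight α x) (Ioo 0 1) := by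
  obtain ⟨C, hC⟩ := isCompact_Icc.exists_bound_of_continuousOn
    (hf.continuousOn (s := Icc (0 : ℝ) 1))
  refine (integrableOn_bmpWeight h0 h1).bdd_mul (c := C) hf.aestronglyMeasurable ?_
  filter_upwards [ae_restrict_mem measurableSet_Ioo] with x hx
  exact hC x (Ioo_subset_Icc_self hx)

lemma tendsto_integral_pow_mul_bmpWeight {α : ℝ} (h0 : 0 < α) (h1 : α < 1) :
    Tendsto (fun n : ℕ => ∫ x in Ioo (0 : ℝ) 1, x ^ n * bmpWeight α x) atTop (nhds 0) := by
  have hz : ∫ _ in Ioo (0 : ℝ) 1, (0 : ℝ) = 0 := integral_zero _ _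
  nth_rewrite 2 [← hz]
  refine tendsto_integral_of_dominated_convergence (fun x => bmpWeight α x)
    (fun n => (integrableOn_mul_bmpWeight h0 h1 (continuous_pow n)).aestronglyMeasurable)
    (integrableOn_bmpWeight h0 h1) (fun n => ?_) ?_
  · filter_upwards [ae_restrict_mem measurableSet_Ioo] with x hx
    have hw := bmpWeight_pos h0 h1 hx
    rw [Real.norm_of_nonneg (mul_nonneg (pow_nonneg hx.1.le _) hw.le)]
    exact mul_le_of_le_one_left hw.le (pow_le_one₀ hx.1.le hx.2.le)
  · filter_upwards [ae_restrict_mem measurableSet_Ioo] with x hx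
    simpa using (tendsto_pow_atTop_nhds_zero_of_lt_one hx.1.le hx.2).mul_const (bmpWeight α x)

/-- In the coordinate `w = exp ζ`, the function `(w - 1) (1 - 1/w)^{-αw} w^{n+1}`. -/
noncomputable def bmpContour (α : ℝ) (n : ℕ) (ζ : ℂ) : ℂ :=
  (Complex.exp ζ - 1) ^ (1 - α * Complex.exp ζ) *
    Complex.exp (α * Complex.exp ζ * ζ + (n + 1) * ζ)

lemma exp_sub_one_im_nonneg {ζ : ℂ} (h : ζ ∈ {ζ : ℂ | 0 ≤ ζ.im ∧ ζ.im ≤ Real.pi}) :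
    0 ≤ (Complex.exp ζ - 1).im := by
  rw [Complex.sub_im, Complex.exp_im, Complex.one_im, sub_zero]
  exact mul_nonneg (Real.exp_nonneg _) (Real.sin_nonneg_of_nonneg_of_le_pi h.1 h.2)

lemma continuousWithinAt_log_upper {u : ℂ} (hu : u ≠ 0) :
    ContinuousWithinAt Complex.log {z | 0 ≤ z.im} u := by
  by_cases hs : u ∈ Complex.slitPlane
  · exact (continuousAt_clog hs).continuousWithinAt
  · rw [Complex.mem_slitPlane_iff] at hs
    push Not at hs
    refine Complex.continuousWithinAt_log_of_re_neg_of_im_zero (lt_of_le_of_ne hs.1 ?_) hs.2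
    exact fun h => hu (Complex.ext h hs.2)

lemma continuousOn_bmpContour {α : ℝ} (h1 : α < 1) (n : ℕ) :
    ContinuousOn (bmpContour α n) {ζ | 0 ≤ ζ.im ∧ ζ.im ≤ Real.pi} := by
  intro ζ hζ
  refine ContinuousWithinAt.mul ?_ (by fun_prop)
  by_cases hw : Complex.exp ζ - 1 = 0
  · have hw1 : Complex.exp ζ = 1 := sub_eq_zero.1 hw
    have hc := Complex.continuousAt_cpow_zero_of_re_pos
      (z := 1 - α * Complex.exp ζ) (by rw [hw1]; simpa using h1)
    rw [← hw] at hc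
    exact (ContinuousAt.comp (f := fun ζ : ℂ =>
      (Complex.exp ζ - 1, 1 - (α : ℂ) * Complex.exp ζ)) hc (by fun_prop)).continuousWithinAt
  · have hlog : ContinuousWithinAt (fun ζ => Complex.log (Complex.exp ζ - 1))
        {ζ | 0 ≤ ζ.im ∧ ζ.im ≤ Real.pi} ζ :=
      ContinuousWithinAt.comp (t := {z : ℂ | 0 ≤ z.im}) (f := fun ζ => Complex.exp ζ - 1)
        (continuousWithinAt_log_upper hw) (by fun_prop)
        (fun z hz => exp_sub_one_im_nonneg hz)
    have hE : ContinuousWithinAt (fun ζ => Complex.exp (Complex.log (Complex.exp ζ - 1) *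
        (1 - α * Complex.exp ζ))) {ζ | 0 ≤ ζ.im ∧ ζ.im ≤ Real.pi} ζ :=
      (hlog.mul (by fun_prop)).cexp
    refine hE.congr_of_eventuallyEq ?_ (Complex.cpow_def_of_ne_zero hw _)
    have hne : ∀ᶠ z in nhds ζ, Complex.exp z - 1 ≠ 0 :=
      ContinuousAt.eventually_ne (by fun_prop) hw
    filter_upwards [nhdsWithin_le_nhds hne] with z hz
    exact Complex.cpow_def_of_ne_zero hz _

lemma differentiableAt_bmpContour (α : ℝ) (n : ℕ) {ζ : ℂ} (h : 0 < ζ.im) (h' : ζ.im < Real.pi) :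
    DifferentiableAt ℂ (bmpContour α n) ζ := by
  have hs : Complex.exp ζ - 1 ∈ Complex.slitPlane := by
    refine Complex.mem_slitPlane_iff.2 (Or.inr ?_)
    rw [Complex.sub_im, Complex.exp_im, Complex.one_im, sub_zero]
    exact (mul_pos (Real.exp_pos _) (Real.sin_pos_of_pos_of_lt_pi h h')).ne'
  unfold bmpContour
  refine DifferentiableAt.mul (DifferentiableAt.cpow (by fun_prop) (by fun_prop) hs)
    (by fun_prop)

lemma bmpContour_of_ne {α : ℝ} {n : ℕ} {ζ : ℂ} (h : Complex.exp ζ - 1 ≠ 0) :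
    bmpContour α n ζ = Complex.exp (Complex.log (Complex.exp ζ - 1) * (1 - α * Complex.exp ζ) +
      (α * Complex.exp ζ * ζ + (n + 1) * ζ)) := by
  rw [bmpContour, Complex.cpow_def_of_ne_zero h, ← Complex.exp_add]

lemma bmpContour_im_of_nonneg (α : ℝ) (n : ℕ) {x : ℝ} (hx : 0 ≤ x) :
    (bmpContour α n x).im = 0 := by
  have h : 0 ≤ Real.exp x - 1 := sub_nonneg.2 (Real.one_le_exp hx)
  have : bmpContour α n x = (((Real.exp x - 1) ^ (1 - α * Real.exp x) *
      Real.exp (α * Real.exp x * x + (n + 1) * x) : ℝ) : ℂ) := by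
    rw [bmpContour]
    push_cast [Complex.ofReal_cpow h]
    rfl
  rw [this, Complex.ofReal_im]

lemma log_neg_ofReal {r : ℝ} (hr : 0 < r) :
    Complex.log (-(r : ℂ)) = Real.log r + Real.pi * Complex.I := by
  rw [← mul_neg_one, Complex.log_ofReal_mul hr (by simp), Complex.log_neg_one]

lemma bmpContour_im_of_neg (α : ℝ) (n : ℕ) {x : ℝ} (hx : x < 0) :
    (bmpContour α n x).im = Real.exp x *
      ((1 - Real.exp x) * Real.exp x ^ n * bmpWeight α (Real.exp x)) := by
  have h : 0 < 1 - Real.exp x := sub_pos.2 (Real.exp_lt_one_iff.2 hx)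
  have hw : Complex.exp x - 1 = -((1 - Real.exp x : ℝ) : ℂ) := by push_cast; ring
  have hne : Complex.exp x - 1 ≠ 0 := by
    rw [hw, neg_ne_zero]
    exact_mod_cast h.ne'
  set t := Real.exp x with ht
  have he : Complex.log (Complex.exp x - 1) * (1 - α * Complex.exp x) +
      (α * Complex.exp x * x + (n + 1) * x) =
      ((Real.log (1 - t) * (1 - α * t) + (α * t * x + (n + 1) * x) : ℝ) : ℂ) +
      ((Real.pi - α * Real.pi * t : ℝ) : ℂ) * Complex.I := by
    rw [hw, log_neg_ofReal h, ht]
    push_cast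
    ring
  rw [bmpContour_of_ne hne, he, Complex.exp_im, Complex.add_re, Complex.add_im,
    Complex.re_ofReal_mul, Complex.im_ofReal_mul, Complex.ofReal_re, Complex.ofReal_im,
    Complex.I_re, Complex.I_im, mul_zero, add_zero, zero_add, mul_one, Real.sin_pi_sub, bmpWeight,
    Real.rpow_def_of_pos (div_pos (Real.exp_pos x) h), Real.log_div (Real.exp_pos x).ne' h.ne',
    Real.log_exp]
  have hexp : Real.exp (Real.log (1 - t) * (1 - α * t) + (α * t * x + (n + 1) * x)) =
      t * ((1 - t) * t ^ n * Real.exp ((x - Real.log (1 - t)) * (α * t))) := by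
    rw [show Real.log (1 - t) * (1 - α * t) + (α * t * x + (n + 1) * x) =
      x + (Real.log (1 - t) + n * x + (x - Real.log (1 - t)) * (α * t)) by ring,
      Real.exp_add, Real.exp_add, Real.exp_add, Real.exp_log h, Real.exp_nat_mul]
  rw [hexp]
  ring

lemma bmpContour_im_of_top (α : ℝ) (n : ℕ) (x : ℝ) :
    (bmpContour α n (x + Real.pi * Complex.I)).im = 0 := by
  have hx : Complex.exp (x + Real.pi * Complex.I) = -(Real.exp x : ℂ) := by
    rw [Complex.exp_add, Complex.exp_pi_mul_I]; push_cast; ring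
  have h : 0 < 1 + Real.exp x := by positivity
  have hw : Complex.exp (x + Real.pi * Complex.I) - 1 = -((1 + Real.exp x : ℝ) : ℂ) := by
    rw [hx]; push_cast; ring
  have hne : Complex.exp (x + Real.pi * Complex.I) - 1 ≠ 0 := by
    rw [hw, neg_ne_zero]
    exact_mod_cast h.ne'
  rw [bmpContour_of_ne hne, hw, log_neg_ofReal h, hx]
  set t := Real.exp x
  have he : ((Real.log (1 + t) : ℂ) + Real.pi * Complex.I) * (1 - α * -(t : ℂ)) +
      (α * -(t : ℂ) * (x + Real.pi * Complex.I) + (n + 1) * (x + Real.pi * Complex.I)) =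
      ((Real.log (1 + t) * (1 + α * t) + (-α * t * x + (n + 1) * x) : ℝ) : ℂ) +
      (((n + 2 : ℕ) * Real.pi : ℝ) : ℂ) * Complex.I := by
    push_cast
    ring
  rw [he, Complex.exp_im, Complex.add_im, Complex.im_ofReal_mul, Complex.ofReal_im,
    Complex.I_im, zero_add, mul_one, Real.sin_nat_mul_pi, mul_zero]

lemma norm_bmpContour_le {α : ℝ} (h0 : 0 < α) (h1 : α < 1) (n : ℕ) {ζ : ℂ}
    (hr : ζ.re ≤ -1) (hi : 0 ≤ ζ.im) (hi' : ζ.im ≤ Real.pi) :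
    ‖bmpContour α n ζ‖ ≤ Real.exp (3 * (1 + Real.pi)) * Real.exp ζ.re := by
  have hw : ‖Complex.exp ζ‖ = Real.exp ζ.re := Complex.norm_exp ζ
  have hw2 : ‖Complex.exp ζ‖ ≤ 1 / 2 := by
    rw [hw]
    refine (Real.exp_le_exp.2 hr).trans ?_
    rw [Real.exp_neg, one_div]
    refine inv_anti₀ two_pos ?_
    linarith [Real.add_one_le_exp (1 : ℝ)]
  have hlow : 1 / 2 ≤ ‖Complex.exp ζ - 1‖ := by
    have := norm_sub_norm_le (1 : ℂ) (Complex.exp ζ)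
    rw [norm_one, norm_sub_rev] at this
    linarith
  have hup : ‖Complex.exp ζ - 1‖ ≤ 3 / 2 := by
    have := norm_sub_le (Complex.exp ζ) (1 : ℂ)
    rw [norm_one] at this
    linarith
  have hne : Complex.exp ζ - 1 ≠ 0 := norm_pos_iff.1 (by linarith)
  have hlog : ‖Complex.log (Complex.exp ζ - 1)‖ ≤ 1 + Real.pi := by
    refine (Complex.norm_le_abs_re_add_abs_im _).trans (add_le_add ?_ ?_)
    · rw [Complex.log_re, abs_le]
      have hpos : 0 < ‖Complex.exp ζ - 1‖ := by linarith
      refine ⟨?_, ?_⟩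
      · have := Real.one_sub_inv_le_log_of_pos hpos
        have : ‖Complex.exp ζ - 1‖⁻¹ ≤ (1 / 2)⁻¹ := inv_anti₀ (by norm_num) hlow
        norm_num at this
        linarith
      · linarith [Real.log_le_sub_one_of_pos hpos]
    · rw [Complex.log_im]
      exact Complex.abs_arg_le_pi _
  have hnα : ‖(α : ℂ)‖ = α := by rw [Complex.norm_real, Real.norm_of_nonneg h0.le]
  have hone : ‖1 - α * Complex.exp ζ‖ ≤ 2 := by
    refine (norm_sub_le _ _).trans ?_
    rw [norm_one, norm_mul, hnα]
    nlinarith [norm_nonneg (Complex.exp ζ)]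
  have hζ : ‖α * Complex.exp ζ * ζ‖ ≤ 1 + Real.pi := by
    have hz : ‖ζ‖ ≤ -ζ.re + Real.pi := by
      refine (Complex.norm_le_abs_re_add_abs_im _).trans ?_
      rw [abs_of_nonpos (by linarith), abs_of_nonneg hi]
      linarith
    have he : Real.exp ζ.re * -ζ.re ≤ 1 := by
      have h2 := Real.add_one_le_exp (-ζ.re)
      calc _ ≤ Real.exp ζ.re * Real.exp (-ζ.re) := by gcongr; linarith
        _ = 1 := by rw [← Real.exp_add]; simp
    have he1 : Real.exp ζ.re ≤ 1 := Real.exp_le_one_iff.2 (by linarith)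
    rw [norm_mul, norm_mul, hnα, hw]
    calc α * Real.exp ζ.re * ‖ζ‖ ≤ 1 * Real.exp ζ.re * (-ζ.re + Real.pi) := by gcongr
      _ = Real.exp ζ.re * -ζ.re + Real.exp ζ.re * Real.pi := by ring
      _ ≤ 1 + Real.pi := by
        have := mul_le_of_le_one_left Real.pi_pos.le he1
        linarith
  rw [bmpContour_of_ne hne, Complex.norm_exp, ← Real.exp_add, Real.exp_le_exp, Complex.add_re,
    Complex.add_re]
  have e1 : (Complex.log (Complex.exp ζ - 1) * (1 - α * Complex.exp ζ)).re ≤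
      (1 + Real.pi) * 2 := by
    refine (Complex.re_le_norm _).trans ?_
    rw [norm_mul]
    have := Real.pi_pos
    gcongr
  have e2 := (Complex.re_le_norm _).trans hζ
  have e3 : (((n : ℂ) + 1) * ζ).re ≤ ζ.re := by
    have : (((n : ℂ) + 1) * ζ).re = (n + 1) * ζ.re := by simp
    rw [this]
    nlinarith [n.cast_nonneg (α := ℝ)]
  linarith

lemma integral_cos_int_mul (j : ℤ) :
    ∫ y in (0 : ℝ)..Real.pi, Real.cos (j * y) = if j = 0 then Real.pi else 0 := by
  split_ifs with h
  · simp [h]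
  · have hj : (j : ℝ) ≠ 0 := by exact_mod_cast h
    rw [intervalIntegral.integral_comp_mul_left _ hj, integral_cos, Real.sin_int_mul_pi]
    simp

lemma norm_exp_neg_one_add_mul_I (y : ℝ) :
    ‖Complex.exp (-(1 + y * Complex.I))‖ = Real.exp (-1) := by
  rw [Complex.norm_exp]; simp

lemma norm_exp_neg_one_add_mul_I_lt (y : ℝ) :
    ‖Complex.exp (-(1 + y * Complex.I))‖ < 1 := by
  rw [norm_exp_neg_one_add_mul_I]; exact Real.exp_lt_one_iff.2 (by norm_num)

lemma continuous_exp_mul_tsum {a : ℕ → ℂ} (ha : ∀ k, ‖a k‖ ≤ 1) (m : ℕ) :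
    Continuous fun y : ℝ => Complex.exp (m * (1 + y * Complex.I)) *
      ∑' k, a k * Complex.exp (-(1 + y * Complex.I)) ^ k := by
  refine Continuous.mul (by fun_prop) (continuous_iff_continuousAt.2 fun y => ?_)
  exact ContinuousAt.comp (f := fun y : ℝ => Complex.exp (-(1 + y * Complex.I)))
    (g := fun z : ℂ => ∑' k, a k * z ^ k)
    (hasDerivAt_tsum_mul_pow ha (norm_exp_neg_one_add_mul_I_lt y)).continuousAt (by fun_prop)

lemma integral_re_exp_mul_tsum {a : ℕ → ℝ} (ha : ∀ k, ‖(a k : ℂ)‖ ≤ 1) (m : ℕ) :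
    ∫ y in (0 : ℝ)..Real.pi, (Complex.exp (m * (1 + y * Complex.I)) *
      ∑' k, (a k : ℂ) * Complex.exp (-(1 + y * Complex.I)) ^ k).re = Real.pi * a m := by
  have hterm : ∀ (k : ℕ) (y : ℝ), (Complex.exp (m * (1 + y * Complex.I)) *
      ((a k : ℂ) * Complex.exp (-(1 + y * Complex.I)) ^ k)).re =
      a k * Real.exp (m - k) * Real.cos (((m - k : ℤ) : ℝ) * y) := by
    intro k y
    have : Complex.exp (m * (1 + y * Complex.I)) *
        ((a k : ℂ) * Complex.exp (-(1 + y * Complex.I)) ^ k) =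
        (a k : ℂ) * Complex.exp (((m - k : ℝ) : ℂ) +
          ((((m - k : ℤ) : ℝ) * y : ℝ) : ℂ) * Complex.I) := by
      rw [← Complex.exp_nat_mul, mul_left_comm, ← Complex.exp_add]
      congr 2
      push_cast
      ring
    rw [this, Complex.re_ofReal_mul, Complex.exp_re, Complex.add_re, Complex.add_im,
      Complex.re_ofReal_mul, Complex.im_ofReal_mul, Complex.ofReal_re, Complex.ofReal_im]
    simp only [Complex.I_re, Complex.I_im, mul_zero, add_zero, zero_add, mul_one]
    ring
  have hsum : Summable fun k : ℕ => Real.exp (m - k) := by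
    have h := (Real.summable_exp_neg_nat).mul_left (Real.exp m)
    refine h.congr fun k => ?_
    rw [← Real.exp_add, sub_eq_add_neg]
  have hmain := intervalIntegral.hasSum_integral_of_dominated_convergence
    (a := 0) (b := Real.pi) (μ := volume)
    (F := fun (k : ℕ) (y : ℝ) => a k * Real.exp (m - k) * Real.cos (((m - k : ℤ) : ℝ) * y))
    (f := fun y : ℝ => (Complex.exp (m * (1 + y * Complex.I)) *
      ∑' k, (a k : ℂ) * Complex.exp (-(1 + y * Complex.I)) ^ k).re)
    (fun k _ => Real.exp (m - k))
    (fun k => (by fun_prop : Continuous _).aestronglyMeasurable)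
    (fun k => ae_of_all _ fun y _ => ?_) (ae_of_all _ fun y _ => hsum)
    intervalIntegrable_const (ae_of_all _ fun y _ => ?_)
  · have hI : ∀ k : ℕ, ∫ y in (0 : ℝ)..Real.pi,
        a k * Real.exp (m - k) * Real.cos (((m - k : ℤ) : ℝ) * y) =
        if k = m then Real.pi * a m else 0 := by
      intro k
      rw [intervalIntegral.integral_const_mul, integral_cos_int_mul]
      by_cases hk : k = m
      · subst hk; simp [mul_comm]
      · rw [if_neg (by omega), if_neg hk, mul_zero]
    simp only [hI] at hmain
    exact hmain.unique (hasSum_ite_eq m _)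
  · have hk : |a k| ≤ 1 := by simpa using ha k
    rw [norm_mul, norm_mul, Real.norm_eq_abs, Real.norm_eq_abs, Real.norm_eq_abs, Real.abs_exp]
    calc _ ≤ 1 * Real.exp (m - k) * 1 := by gcongr; exact Real.abs_cos_le_one _
      _ = _ := by ring
  · have h1 := (summable_mul_pow_of_norm_le_one ha
      (norm_exp_neg_one_add_mul_I_lt y)).of_norm.hasSum.mul_left
        (Complex.exp (m * (1 + y * Complex.I)))
    have h2 := Complex.hasSum_re h1
    simpa only [hterm] using h2

lemma log_exp_sub_one {ζ : ℂ} (hr : 0 < ζ.re) (hi : 0 ≤ ζ.im) (hi' : ζ.im ≤ Real.pi) :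
    Complex.log (Complex.exp ζ - 1) = ζ + Complex.log (1 - Complex.exp (-ζ)) := by
  have hz : ‖Complex.exp (-ζ)‖ < 1 := by
    rw [Complex.norm_exp, Complex.neg_re]; exact Real.exp_lt_one_iff.2 (by linarith)
  have hre : 0 < (1 - Complex.exp (-ζ)).re := by
    have := Complex.re_le_norm (Complex.exp (-ζ))
    rw [Complex.sub_re, Complex.one_re]; linarith
  have hne1 : 1 - Complex.exp (-ζ) ≠ 0 := fun h => by simp [h] at hre
  have hmul : Complex.exp ζ - 1 = Complex.exp ζ * (1 - Complex.exp (-ζ)) := by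
    rw [mul_sub, ← Complex.exp_add]; simp
  have hne : Complex.exp ζ - 1 ≠ 0 := by
    rw [hmul]; exact mul_ne_zero (Complex.exp_ne_zero _) hne1
  have hexp : Complex.exp (ζ + Complex.log (1 - Complex.exp (-ζ)) -
      Complex.log (Complex.exp ζ - 1)) = 1 := by
    rw [Complex.exp_sub, Complex.exp_add, Complex.exp_log hne1, Complex.exp_log hne, ← hmul,
      div_self hne]
  obtain ⟨k, hk⟩ := Complex.exp_eq_one_iff.1 hexp
  have him := congrArg Complex.im hk
  have harg := abs_lt.1 (Complex.abs_arg_lt_pi_div_two_iff.2 (Or.inl hre))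
  have harg1 : 0 ≤ (Complex.exp ζ - 1).arg :=
    Complex.arg_nonneg_iff.2 (exp_sub_one_im_nonneg ⟨hi, hi'⟩)
  have harg2 := Complex.arg_le_pi (Complex.exp ζ - 1)
  simp [Complex.log_im] at him
  have hpi := Real.pi_pos
  have hk1 : (k : ℝ) < 1 := by nlinarith
  have hk2 : (-1 : ℝ) < k := by nlinarith
  have hk0 : k = 0 := by
    have : k < 1 := by exact_mod_cast hk1
    have : -1 < k := by exact_mod_cast hk2
    omega
  rw [hk0] at hk
  simp only [Int.cast_zero, zero_mul] at hk
  exact (sub_eq_zero.1 hk).symm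

lemma bmpContour_eq_of_re_pos {α : ℝ} (h0 : 0 < α) (h1 : α < 1) (n : ℕ) {ζ : ℂ}
    (hr : 0 < ζ.re) (hi : 0 ≤ ζ.im) (hi' : ζ.im ≤ Real.pi) :
    bmpContour α n ζ = Complex.exp α * (Complex.exp ((n + 2 : ℕ) * ζ) *
        ∑' k, ((bmpP α k : ℝ) : ℂ) * Complex.exp (-ζ) ^ k -
      Complex.exp ((n + 1 : ℕ) * ζ) * ∑' k, ((bmpP α k : ℝ) : ℂ) * Complex.exp (-ζ) ^ k) := by
  have hz : ‖Complex.exp (-ζ)‖ < 1 := by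
    rw [Complex.norm_exp, Complex.neg_re]; exact Real.exp_lt_one_iff.2 (by linarith)
  have hgen := exp_mul_neg_log_one_sub_eq h0.le h1.le hz (Complex.exp_ne_zero _)
  have hlog := log_exp_sub_one hr hi hi'
  have hne : Complex.exp ζ - 1 ≠ 0 := by
    intro h
    have := congrArg norm (sub_eq_zero.1 h)
    rw [Complex.norm_exp, norm_one, Real.exp_eq_one_iff] at this
    exact hr.ne' this
  rw [mul_sub, mul_left_comm, mul_left_comm (Complex.exp α), ← hgen, bmpContour_of_ne hne]
  rw [show Complex.log (Complex.exp ζ - 1) * (1 - α * Complex.exp ζ) +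
      (α * Complex.exp ζ * ζ + (n + 1) * ζ) = Complex.log (Complex.exp ζ - 1) +
      ((n + 1 : ℕ) * ζ + α * ((Complex.exp (-ζ))⁻¹ * -Complex.log (1 - Complex.exp (-ζ)))) by
    rw [← Complex.exp_neg, neg_neg]
    push_cast
    linear_combination (-(α : ℂ) * Complex.exp ζ) * hlog,
    Complex.exp_add, Complex.exp_log hne, Complex.exp_add,
    show ((n + 2 : ℕ) : ℂ) * ζ = ζ + (n + 1 : ℕ) * ζ by push_cast; ring, Complex.exp_add]
  ring

lemma integral_re_bmpContour {α : ℝ} (h0 : 0 < α) (h1 : α < 1) (n : ℕ) :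
    ∫ y in (0 : ℝ)..Real.pi, (bmpContour α n (1 + y * Complex.I)).re =
      Real.pi * (Real.exp α * (bmpP α (n + 2) - bmpP α (n + 1))) := by
  have hp := norm_bmpP_le_one h0.le h1.le
  have heq : ∀ y ∈ uIcc (0 : ℝ) Real.pi, (bmpContour α n (1 + y * Complex.I)).re =
      Real.exp α * ((Complex.exp ((n + 2 : ℕ) * (1 + y * Complex.I)) *
        ∑' k, ((bmpP α k : ℝ) : ℂ) * Complex.exp (-(1 + y * Complex.I)) ^ k).re -
      (Complex.exp ((n + 1 : ℕ) * (1 + y * Complex.I)) *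
        ∑' k, ((bmpP α k : ℝ) : ℂ) * Complex.exp (-(1 + y * Complex.I)) ^ k).re) := by
    intro y hy
    rw [uIcc_of_le Real.pi_pos.le] at hy
    rw [bmpContour_eq_of_re_pos h0 h1 n (by simp) (by simpa using hy.1) (by simpa using hy.2),
      ← Complex.ofReal_exp, Complex.re_ofReal_mul, Complex.sub_re]
  have hc : ∀ m : ℕ, Continuous fun y : ℝ => (Complex.exp (m * (1 + y * Complex.I)) *
      ∑' k, ((bmpP α k : ℝ) : ℂ) * Complex.exp (-(1 + y * Complex.I)) ^ k).re :=
    fun m => Complex.continuous_re.comp (continuous_exp_mul_tsum hp m)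
  rw [intervalIntegral.integral_congr heq, intervalIntegral.integral_const_mul,
    intervalIntegral.integral_sub ((hc _).intervalIntegrable _ _)
      ((hc _).intervalIntegrable _ _),
    integral_re_exp_mul_tsum hp, integral_re_exp_mul_tsum hp]
  ring

lemma integral_im_bmpContour {α : ℝ} (h0 : 0 < α) (h1 : α < 1) (n : ℕ) {L : ℝ} (hL : 0 < L) :
    (∫ x in (-L)..0, (bmpContour α n x).im) =
      Real.pi * (Real.exp α * (bmpP α (n + 1) - bmpP α (n + 2))) +
        (∫ y in (0 : ℝ)..Real.pi, bmpContour α n (-L + y * Complex.I)).re := by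
  have hc := continuousOn_bmpContour h1 n
  have hpi := Real.pi_pos
  have hrect := Complex.integral_boundary_rect_eq_zero_of_continuousOn_of_differentiableOn
    (bmpContour α n) (-(L : ℂ)) (1 + Real.pi * Complex.I)
    (hc.mono fun ζ hζ => by
      have h := (Complex.mem_reProdIm.1 hζ).2
      simp only [Complex.neg_im, Complex.ofReal_im, neg_zero, Complex.add_im, Complex.one_im,
        zero_add, Complex.im_ofReal_mul, Complex.I_im, mul_one] at h
      rwa [uIcc_of_le hpi.le] at h)
    (fun ζ hζ => by
      have h := (Complex.mem_reProdIm.1 hζ).2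
      simp only [Complex.neg_im, Complex.ofReal_im, neg_zero, Complex.add_im, Complex.one_im,
        zero_add, Complex.im_ofReal_mul, Complex.I_im, mul_one] at h
      rw [min_eq_left hpi.le, max_eq_right hpi.le] at h
      exact (differentiableAt_bmpContour α n h.1 h.2).differentiableWithinAt)
  simp only [Complex.neg_im, Complex.ofReal_im, neg_zero, Complex.add_im, Complex.one_im,
    zero_add, Complex.im_ofReal_mul, Complex.I_im, mul_one, Complex.neg_re, Complex.ofReal_re,
    Complex.add_re, Complex.one_re, Complex.re_ofReal_mul, Complex.I_re, mul_zero, add_zero,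
    Complex.ofReal_zero, zero_mul, Complex.ofReal_neg, Complex.ofReal_one, smul_eq_mul] at hrect
  have hbot : ContinuousOn (fun x : ℝ => bmpContour α n x) (uIcc (-L) 1) :=
    hc.comp (by fun_prop) fun x _ => ⟨by simp, by simpa using hpi.le⟩
  have htop : ContinuousOn (fun x : ℝ => bmpContour α n (x + Real.pi * Complex.I))
      (uIcc (-L) 1) :=
    hc.comp (by fun_prop) fun x _ => ⟨by simpa using hpi.le, by simp⟩
  have hright : ContinuousOn (fun y : ℝ => bmpContour α n (1 + y * Complex.I))
      (uIcc 0 Real.pi) := by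
    refine hc.comp (by fun_prop) fun y hy => ?_
    rw [uIcc_of_le hpi.le] at hy
    exact ⟨by simpa using hy.1, by simpa using hy.2⟩
  have im_integral : ∀ {f : ℝ → ℂ} {a b : ℝ}, ContinuousOn f (uIcc a b) →
      (∫ x in a..b, f x).im = ∫ x in a..b, (f x).im := fun hf =>
    (Complex.imCLM.intervalIntegral_comp_comm hf.intervalIntegrable).symm
  have re_integral : ∀ {f : ℝ → ℂ} {a b : ℝ}, ContinuousOn f (uIcc a b) →
      (∫ x in a..b, f x).re = ∫ x in a..b, (f x).re := fun hf =>
    (Complex.reCLM.intervalIntegral_comp_comm hf.intervalIntegrable).symm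
  have him := congrArg Complex.im hrect
  rw [Complex.sub_im, Complex.add_im, Complex.sub_im, Complex.I_mul_im, Complex.I_mul_im,
    im_integral hbot, im_integral htop, re_integral hright, integral_re_bmpContour h0 h1 n,
    Complex.zero_im] at him
  simp only [bmpContour_im_of_top, intervalIntegral.integral_zero] at him
  have hbotim : ContinuousOn (fun x : ℝ => (bmpContour α n x).im) (uIcc (-L) 1) :=
    Complex.continuous_im.comp_continuousOn hbot
  have hmem : (0 : ℝ) ∈ uIcc (-L) 1 := by
    rw [uIcc_of_le (by linarith)]
    exact ⟨by linarith, zero_le_one⟩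
  have hsplit := intervalIntegral.integral_add_adjacent_intervals (μ := volume)
    (hbotim.mono (uIcc_subset_uIcc left_mem_uIcc hmem)).intervalIntegrable
    (hbotim.mono (uIcc_subset_uIcc hmem right_mem_uIcc)).intervalIntegrable
  have hzero : ∫ x in (0 : ℝ)..1, (bmpContour α n x).im = 0 := by
    rw [intervalIntegral.integral_congr (g := fun _ => (0 : ℝ)), intervalIntegral.integral_zero]
    intro x hx
    rw [uIcc_of_le zero_le_one] at hx
    exact bmpContour_im_of_nonneg α n hx.1
  rw [hzero, add_zero] at hsplit
  rw [hsplit]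
  linarith

lemma exp_image_Iio : Real.exp '' Iio 0 = Ioo 0 1 := by
  ext t
  constructor
  · rintro ⟨x, hx, rfl⟩
    exact ⟨Real.exp_pos x, Real.exp_lt_one_iff.2 hx⟩
  · intro ht
    exact ⟨Real.log t, Real.log_neg ht.1 ht.2, Real.exp_log ht.1⟩

lemma integral_one_sub_mul_pow_mul_bmpWeight {α : ℝ} (h0 : 0 < α) (h1 : α < 1) (n : ℕ) :
    ∫ x in Ioo (0 : ℝ) 1, ((1 - x) * x ^ n) * bmpWeight α x =
      Real.pi * (Real.exp α * (bmpP α (n + 1) - bmpP α (n + 2))) := by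
  have hd : ∀ x ∈ Iio (0 : ℝ), HasDerivWithinAt Real.exp (Real.exp x) (Iio 0) x :=
    fun x _ => (Real.hasDerivAt_exp x).hasDerivWithinAt
  have hinj : InjOn Real.exp (Iio 0) := Real.exp_injective.injOn
  have hG := integrableOn_mul_bmpWeight h0 h1 (f := fun x => (1 - x) * x ^ n) (by fun_prop)
  have heq : ∀ x ∈ Iio (0 : ℝ), |Real.exp x| • (((1 - Real.exp x) * Real.exp x ^ n) *
      bmpWeight α (Real.exp x)) = (bmpContour α n x).im := by
    intro x hx
    rw [bmpContour_im_of_neg α n hx, Real.abs_exp, smul_eq_mul]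
  rw [← exp_image_Iio] at hG ⊢
  rw [integral_image_eq_integral_abs_deriv_smul measurableSet_Iio hd hinj,
    setIntegral_congr_fun measurableSet_Iio heq]
  rw [integrableOn_image_iff_integrableOn_abs_deriv_smul measurableSet_Iio hd hinj,
    integrableOn_congr_fun heq measurableSet_Iio, ← integrableOn_Iic_iff_integrableOn_Iio] at hG
  have hlim := intervalIntegral_tendsto_integral_Iic 0 hG tendsto_neg_atTop_atBot
  rw [← integral_Iic_eq_integral_Iio]
  refine tendsto_nhds_unique hlim ?_
  have hleft : Tendsto (fun L : ℝ =>
      (∫ y in (0 : ℝ)..Real.pi, bmpContour α n (-L + y * Complex.I)).re) atTop (nhds 0) := by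
    have hexp : Tendsto (fun L : ℝ => Real.exp (3 * (1 + Real.pi)) * Real.exp (-L) *
        |Real.pi - 0|) atTop (nhds 0) := by
      simpa using ((Real.tendsto_exp_neg_atTop_nhds_zero.const_mul
        (Real.exp (3 * (1 + Real.pi)))).mul_const |Real.pi - 0|)
    refine squeeze_zero_norm' ?_ hexp
    filter_upwards [eventually_ge_atTop 1] with L hL
    refine (Complex.abs_re_le_norm _).trans
      (intervalIntegral.norm_integral_le_of_norm_le_const fun y hy => ?_)
    rw [uIoc_of_le Real.pi_pos.le] at hy
    have := norm_bmpContour_le h0 h1 n (ζ := -L + y * Complex.I) (by simpa using hL)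
      (by simpa using hy.1.le) (by simpa using hy.2)
    simpa using this
  have h := hleft.const_add (Real.pi * (Real.exp α * (bmpP α (n + 1) - bmpP α (n + 2))))
  rw [add_zero] at h
  refine h.congr' ?_
  filter_upwards [eventually_gt_atTop 0] with L hL
  exact (integral_im_bmpContour h0 h1 n hL).symm

lemma exp_mul_bmpP_succ {α : ℝ} (h0 : 0 < α) (h1 : α < 1) (n : ℕ) :
    Real.exp α * bmpP α (n + 1) =
      (1 / Real.pi) * ∫ x in Ioo (0 : ℝ) 1, x ^ n * bmpWeight α x := by
  set D : ℕ → ℝ := fun n => Real.exp α * bmpP α (n + 1) -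
    (1 / Real.pi) * ∫ x in Ioo (0 : ℝ) 1, x ^ n * bmpWeight α x with hD
  have hstep : ∀ n, D (n + 1) = D n := by
    intro n
    have h := integral_one_sub_mul_pow_mul_bmpWeight h0 h1 n
    have hi : ∀ m : ℕ, IntegrableOn (fun x => x ^ m * bmpWeight α x) (Ioo 0 1) :=
      fun m => integrableOn_mul_bmpWeight h0 h1 (continuous_pow m)
    have hs : ∫ x in Ioo (0 : ℝ) 1, ((1 - x) * x ^ n) * bmpWeight α x =
        (∫ x in Ioo (0 : ℝ) 1, x ^ n * bmpWeight α x) -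
          ∫ x in Ioo (0 : ℝ) 1, x ^ (n + 1) * bmpWeight α x := by
      rw [← integral_sub (hi n) (hi (n + 1))]
      refine integral_congr_ae (ae_of_all _ fun x => ?_)
      ring
    rw [hs] at h
    have hpi := Real.pi_ne_zero
    simp only [hD]
    field_simp
    linear_combination h
  have hconst : ∀ n, D n = D 0 := by
    intro n
    induction n with
    | zero => rfl
    | succ n ih => rw [hstep, ih]
  have hlim : Tendsto D atTop (nhds 0) := by
    simpa [hD] using ((tendsto_bmpP_atTop h0.le h1).const_mul (Real.exp α)).sub
      ((tendsto_integral_pow_mul_bmpWeight h0 h1).const_mul (1 / Real.pi))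
  have hD0 : D 0 = 0 := by
    refine tendsto_nhds_unique (tendsto_const_nhds.congr fun n => ?_) hlim
    exact (hconst n).symm
  exact sub_eq_zero.1 ((hconst n).trans hD0)

lemma bmpPhiR_eq_integral {α : ℝ} (h0 : 0 < α) (h1 : α < 1) (s : ℝ) :
    bmpPhiR α s =
      (1 / Real.pi) * ∫ x in Ioo (0 : ℝ) 1, bmpWeight α x * Real.exp (-s * x) := by
  have hexp : ∀ t : ℝ, HasSum (fun n : ℕ => t ^ n / n.factorial) (Real.exp t) := by
    intro t
    rw [Real.exp_eq_exp_ℝ]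
    exact NormedSpace.expSeries_div_hasSum_exp t
  have hsum := hasSum_integral_of_dominated_convergence (μ := volume.restrict (Ioo (0 : ℝ) 1))
    (F := fun (n : ℕ) x => ((-s) ^ n / n.factorial) * (x ^ n * bmpWeight α x))
    (f := fun x => bmpWeight α x * Real.exp (-s * x))
    (fun n x => |s| ^ n / n.factorial * bmpWeight α x)
    (fun n => ((integrableOn_mul_bmpWeight h0 h1 (continuous_pow n)).const_mul
      _).aestronglyMeasurable) (fun n => ?_)
    (ae_of_all _ fun x => (hexp |s|).summable.mul_right _) ?_ (ae_of_all _ fun x => ?_)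
  · rw [bmpPhiR, ← hsum.tsum_eq, ← tsum_mul_left, ← tsum_mul_left]
    refine tsum_congr fun n => ?_
    rw [integral_const_mul]
    have h := exp_mul_bmpP_succ h0 h1 n
    rw [neg_pow s n]
    linear_combination ((-1) ^ n * s ^ n / n.factorial) * h
  · filter_upwards [ae_restrict_mem measurableSet_Ioo] with x hx
    have hw := bmpWeight_pos h0 h1 hx
    rw [norm_mul, norm_mul, norm_div, norm_pow, norm_neg, Real.norm_eq_abs,
      Real.norm_of_nonneg hw.le, Real.norm_of_nonneg (pow_nonneg hx.1.le n),
      Real.norm_of_nonneg (Nat.cast_nonneg _)]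
    gcongr
    exact mul_le_of_le_one_left hw.le (pow_le_one₀ hx.1.le hx.2.le)
  · simp only [tsum_mul_right]
    exact (integrableOn_bmpWeight h0 h1).const_mul _
  · have h := (hexp (-s * x)).mul_left (bmpWeight α x)
    refine h.congr_fun fun n => ?_
    rw [mul_pow]
    ring

/-- For `0 < α < 1` and `s ≥ 0`,
`φ_α(s) = (1/π) ∫_0^1 (x/(1−x))^{αx} sin(απx) e^{−sx} dx > 0`. -/
theorem stmt5 (α : ℝ) (h0 : 0 < α) (h1 : α < 1) (s : ℝ) (hs : 0 ≤ s) :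
    MeasureTheory.IntegrableOn
      (fun x : ℝ => (x / (1 - x)) ^ (α * x) * Real.sin (α * Real.pi * x) * Real.exp (-s * x))
      (Set.Ioo 0 1) ∧
    bmpPhiR α s = (1 / Real.pi) * ∫ x in Set.Ioo (0 : ℝ) 1,
      (x / (1 - x)) ^ (α * x) * Real.sin (α * Real.pi * x) * Real.exp (-s * x) ∧
    0 < bmpPhiR α s := by
  have hint : IntegrableOn (fun x => bmpWeight α x * Real.exp (-s * x)) (Ioo 0 1) := by
    simpa only [mul_comm] using
      integrableOn_mul_bmpWeight h0 h1 (f := fun x => Real.exp (-s * x)) (by fun_prop)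
  refine ⟨hint, bmpPhiR_eq_integral h0 h1 s, ?_⟩
  have hpos : ∀ x ∈ Ioo (0 : ℝ) 1, 0 < bmpWeight α x * Real.exp (-s * x) :=
    fun x hx => mul_pos (bmpWeight_pos h0 h1 hx) (Real.exp_pos _)
  rw [bmpPhiR_eq_integral h0 h1 s]
  refine mul_pos (by positivity) ((setIntegral_pos_iff_support_of_nonneg_ae ?_ hint).2 ?_)
  · filter_upwards [ae_restrict_mem measurableSet_Ioo] with x hx
    exact (hpos x hx).le
  · have hsub : Ioo (0 : ℝ) 1 ⊆
        Function.support fun x => bmpWeight α x * Real.exp (-s * x) :=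
      fun x hx => (hpos x hx).ne'
    rw [inter_eq_right.2 hsub]
    simp
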